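/- arXiv:hep-th/0006106 — 2 statements merged into one kernel-verified Lean document; each statement's English description precedes it below -/
import Mathlib

section
/- (Nested subtractions annihilate: S_Γ W_γ = 0.) Let ω_Γ, ω_γ ∈ ℕ with ω_γ ≥ ω_Γ, let w_Γ be an admissible auxiliary function of order ω_Γ and w_γ an admissible auxiliary function of order ω_γ, and let W_Γ = W_{ω_Γ, w_Γ}, W_γ = W_{ω_γ, w_γ} be the corresponding Epstein–Glaser subtraction operators with S_Γ := id − W_Γ. Then S_Γ ∘ W_γ = 0 on smooth functions; that is, for every smooth φ : ℝ^d → ℝ, W_Γ(W_γ φ) = W_γ φ. -/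
open Finset

/-- The partial derivative `∂ᵢ` of a function on `ℝ^d`. -/
noncomputable def pderivFun {d : ℕ} (i : Fin d) (f : (Fin d → ℝ) → ℝ) : (Fin d → ℝ) → ℝ :=
  fun x => fderiv ℝ f x (Pi.single i 1)

/-- The iterated partial derivative `∂_a` associated to a multi-index `a : Fin d → ℕ`. -/
noncomputable def mderiv {d : ℕ} (a : Fin d → ℕ) (f : (Fin d → ℝ) → ℝ) : (Fin d → ℝ) → ℝ :=
  (List.finRange d).foldr (fun i g => (pderivFun i)^[a i] g) f

/-- The Epstein–Glaser subtraction operator `W = W_{ω,w}`: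
`(Wφ)(x) = φ(x) − w(x) Σ_{|a| ≤ ω} (x^a / a!) ∂_aφ(0)`. -/
noncomputable def EGsub (d ω : ℕ) (w φ : (Fin d → ℝ) → ℝ) : (Fin d → ℝ) → ℝ :=
  fun x => φ x - w x *
    ∑ a ∈ Finset.univ.filter (fun a : Fin d → Fin (ω + 1) => (∑ i, ((a i : ℕ))) ≤ ω),
      ((∏ i, x i ^ (a i : ℕ)) / ((∏ i, Nat.factorial (a i : ℕ) : ℕ) : ℝ)) *
        mderiv (fun i => (a i : ℕ)) φ 0

/-- `w` is an admissible auxiliary function of order `ω`: it is smooth, `w(0) = 1`, and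
`∂_a w(0) = 0` for all multi-indices `a` with `1 ≤ |a| ≤ ω`. -/
def IsAdmissible (d ω : ℕ) (w : (Fin d → ℝ) → ℝ) : Prop :=
  ContDiff ℝ (⊤ : ℕ∞) w ∧ w 0 = 1 ∧
    ∀ a : Fin d → ℕ, 1 ≤ ∑ i, a i → (∑ i, a i) ≤ ω → mderiv a w 0 = 0

/-- The iterated partial derivative along the directions in a list `l`, with orders `a`. -/
noncomputable def mderivList {d : ℕ} (l : List (Fin d)) (a : Fin d → ℕ) (f : (Fin d → ℝ) → ℝ) :
    (Fin d → ℝ) → ℝ :=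
  l.foldr (fun i g => (pderivFun i)^[a i] g) f

section pderivFun

variable {d : ℕ} {f g : (Fin d → ℝ) → ℝ}

theorem contDiff_pderivFun (hf : ContDiff ℝ (⊤ : ℕ∞) f) (i : Fin d) :
    ContDiff ℝ (⊤ : ℕ∞) (pderivFun i f) :=
  (hf.fderiv_right (m := (⊤ : ℕ∞)) (by simp)).clm_apply contDiff_const

theorem contDiff_iterate_pderivFun (hf : ContDiff ℝ (⊤ : ℕ∞) f) (i : Fin d) (k : ℕ) :
    ContDiff ℝ (⊤ : ℕ∞) ((pderivFun i)^[k] f) := by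
  induction k with
  | zero => exact hf
  | succ k ih => rw [Function.iterate_succ_apply']; exact contDiff_pderivFun ih i

theorem differentiableAt_of_smooth (hf : ContDiff ℝ (⊤ : ℕ∞) f) (x : Fin d → ℝ) :
    DifferentiableAt ℝ f x :=
  (hf.differentiable (by simp)) x

theorem pderivFun_add (hf : ContDiff ℝ (⊤ : ℕ∞) f) (hg : ContDiff ℝ (⊤ : ℕ∞) g) (i : Fin d) :
    pderivFun i (f + g) = pderivFun i f + pderivFun i g := by
  funext x
  simp [pderivFun,
    fderiv_add (differentiableAt_of_smooth hf x) (differentiableAt_of_smooth hg x)]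

theorem pderivFun_smul (c : ℝ) (hf : ContDiff ℝ (⊤ : ℕ∞) f) (i : Fin d) :
    pderivFun i (c • f) = c • pderivFun i f := by
  funext x
  simp [pderivFun, fderiv_const_smul (differentiableAt_of_smooth hf x)]

theorem pderivFun_mul (hf : ContDiff ℝ (⊤ : ℕ∞) f) (hg : ContDiff ℝ (⊤ : ℕ∞) g) (i : Fin d) :
    pderivFun i (f * g) = pderivFun i f * g + f * pderivFun i g := by
  funext x
  simp [pderivFun,
    fderiv_mul (differentiableAt_of_smooth hf x) (differentiableAt_of_smooth hg x)]
  ring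

theorem pderivFun_comm (hf : ContDiff ℝ (⊤ : ℕ∞) f) (i j : Fin d) :
    pderivFun i (pderivFun j f) = pderivFun j (pderivFun i f) := by
  have key : ∀ (i j : Fin d) (x : Fin d → ℝ), pderivFun i (pderivFun j f) x =
      fderiv ℝ (fderiv ℝ f) x (Pi.single i 1) (Pi.single j 1) := by
    intro i j x
    have h : DifferentiableAt ℝ (fderiv ℝ f) x :=
      (hf.fderiv_right (m := (⊤ : ℕ∞)) (by simp)).differentiable (by simp) x
    change fderiv ℝ (fun y => fderiv ℝ f y (Pi.single j 1)) x (Pi.single i 1) = _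
    rw [fderiv_clm_apply h (differentiableAt_const _)]
    simp
  funext x
  rw [key, key]
  exact (hf.contDiffAt.isSymmSndFDerivAt (by
    simpa using (WithTop.coe_le_coe.mpr le_top : ((2 : ℕ∞) : WithTop ℕ∞) ≤ (⊤ : ℕ∞)))) _ _

theorem iterate_pderivFun_comm (hf : ContDiff ℝ (⊤ : ℕ∞) f) (i j : Fin d) (k : ℕ) :
    (pderivFun i)^[k] (pderivFun j f) = pderivFun j ((pderivFun i)^[k] f) := by
  induction k with
  | zero => rfl
  | succ k ih =>
    rw [Function.iterate_succ_apply', ih, pderivFun_comm (contDiff_iterate_pderivFun hf i k),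
      Function.iterate_succ_apply']

theorem iterate_pderivFun_add (hf : ContDiff ℝ (⊤ : ℕ∞) f) (hg : ContDiff ℝ (⊤ : ℕ∞) g)
    (i : Fin d) (k : ℕ) :
    (pderivFun i)^[k] (f + g) = (pderivFun i)^[k] f + (pderivFun i)^[k] g := by
  induction k with
  | zero => rfl
  | succ k ih =>
    simp only [Function.iterate_succ_apply']
    rw [ih, pderivFun_add (contDiff_iterate_pderivFun hf i k) (contDiff_iterate_pderivFun hg i k)]

theorem iterate_pderivFun_smul (c : ℝ) (hf : ContDiff ℝ (⊤ : ℕ∞) f) (i : Fin d) (k : ℕ) :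
    (pderivFun i)^[k] (c • f) = c • (pderivFun i)^[k] f := by
  induction k with
  | zero => rfl
  | succ k ih =>
    simp only [Function.iterate_succ_apply']
    rw [ih, pderivFun_smul c (contDiff_iterate_pderivFun hf i k)]

end pderivFun

section mderiv

variable {d : ℕ} {f g : (Fin d → ℝ) → ℝ}

theorem mderivList_cons (i : Fin d) (l : List (Fin d)) (a : Fin d → ℕ) :
    mderivList (i :: l) a f = (pderivFun i)^[a i] (mderivList l a f) := rfl

theorem contDiff_mderivList (hf : ContDiff ℝ (⊤ : ℕ∞) f) (l : List (Fin d)) (a : Fin d → ℕ) :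
    ContDiff ℝ (⊤ : ℕ∞) (mderivList l a f) := by
  induction l with
  | nil => exact hf
  | cons i l ih => exact contDiff_iterate_pderivFun ih i _

theorem mderivList_pderivFun (hf : ContDiff ℝ (⊤ : ℕ∞) f) (l : List (Fin d)) (a : Fin d → ℕ)
    (j : Fin d) : mderivList l a (pderivFun j f) = pderivFun j (mderivList l a f) := by
  induction l with
  | nil => rfl
  | cons i l ih =>
    rw [mderivList_cons, ih, iterate_pderivFun_comm (contDiff_mderivList hf l a), mderivList_cons]

theorem mderivList_add_single_of_notMem (l : List (Fin d)) (a : Fin d → ℕ) {j : Fin d}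
    (hj : j ∉ l) : mderivList l (a + Pi.single j 1) f = mderivList l a f := by
  induction l with
  | nil => rfl
  | cons i l ih =>
    rw [List.mem_cons, not_or] at hj
    rw [mderivList_cons, mderivList_cons, ih hj.2]
    simp [Pi.single_eq_of_ne (Ne.symm hj.1)]

theorem mderivList_add_single (hf : ContDiff ℝ (⊤ : ℕ∞) f) {l : List (Fin d)} (hl : l.Nodup)
    (a : Fin d → ℕ) {j : Fin d} (hj : j ∈ l) :
    mderivList l (a + Pi.single j 1) f = pderivFun j (mderivList l a f) := by
  induction l with
  | nil => simp at hj
  | cons i l ih =>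
    rw [List.nodup_cons] at hl
    rw [mderivList_cons, mderivList_cons]
    by_cases hij : j = i
    · subst hij
      rw [mderivList_add_single_of_notMem l a hl.1, Pi.add_apply, Pi.single_eq_same,
        Function.iterate_succ_apply']
    · have hjl : j ∈ l := (List.mem_cons.mp hj).resolve_left hij
      rw [ih hl.2 hjl, iterate_pderivFun_comm (contDiff_mderivList hf l a)]
      simp [Pi.single_eq_of_ne (Ne.symm hij)]

theorem mderiv_pderivFun (hf : ContDiff ℝ (⊤ : ℕ∞) f) (a : Fin d → ℕ) (j : Fin d) :
    mderiv a (pderivFun j f) = mderiv (a + Pi.single j 1) f :=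
  (mderivList_pderivFun hf _ a j).trans
    (mderivList_add_single hf (List.nodup_finRange d) a (List.mem_finRange j)).symm

theorem mderiv_zero (f : (Fin d → ℝ) → ℝ) : mderiv 0 f = f := by
  change mderivList (List.finRange d) 0 f = f
  induction List.finRange d with
  | nil => rfl
  | cons i l ih => rw [mderivList_cons, ih]; rfl

theorem mderiv_add (hf : ContDiff ℝ (⊤ : ℕ∞) f) (hg : ContDiff ℝ (⊤ : ℕ∞) g) (a : Fin d → ℕ) :
    mderiv a (f + g) = mderiv a f + mderiv a g := by
  change mderivList (List.finRange d) a (f + g) =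
    mderivList (List.finRange d) a f + mderivList (List.finRange d) a g
  induction List.finRange d with
  | nil => rfl
  | cons i l ih =>
    simp only [mderivList_cons]
    rw [ih, iterate_pderivFun_add (contDiff_mderivList hf l a) (contDiff_mderivList hg l a)]

theorem mderiv_smul (c : ℝ) (hf : ContDiff ℝ (⊤ : ℕ∞) f) (a : Fin d → ℕ) :
    mderiv a (c • f) = c • mderiv a f := by
  change mderivList (List.finRange d) a (c • f) = c • mderivList (List.finRange d) a f
  induction List.finRange d with
  | nil => rfl
  | cons i l ih =>
    simp only [mderivList_cons]
    rw [ih, iterate_pderivFun_smul c (contDiff_mderivList hf l a)]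

theorem mderiv_sub (hf : ContDiff ℝ (⊤ : ℕ∞) f) (hg : ContDiff ℝ (⊤ : ℕ∞) g) (a : Fin d → ℕ) :
    mderiv a (f - g) = mderiv a f - mderiv a g := by
  have h : f - g = f + (-1 : ℝ) • g := by rw [neg_one_smul, sub_eq_add_neg]
  rw [h, mderiv_add (g := (-1 : ℝ) • g) hf (hg.const_smul (-1 : ℝ)), mderiv_smul _ hg, neg_one_smul,
    sub_eq_add_neg]

theorem contDiff_sum_smul {ι : Type*} (s : Finset ι) (c : ι → ℝ) (F : ι → (Fin d → ℝ) → ℝ)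
    (hF : ∀ i, ContDiff ℝ (⊤ : ℕ∞) (F i)) : ContDiff ℝ (⊤ : ℕ∞) (∑ i ∈ s, c i • F i) := by
  have h : (∑ i ∈ s, c i • F i) = fun x => ∑ i ∈ s, c i • F i x := by
    funext x; simp
  rw [h]
  exact ContDiff.sum fun i _ => (hF i).const_smul (c i)

theorem mderiv_sum_smul {ι : Type*} (s : Finset ι) (c : ι → ℝ) (F : ι → (Fin d → ℝ) → ℝ)
    (hF : ∀ i, ContDiff ℝ (⊤ : ℕ∞) (F i)) (a : Fin d → ℕ) :
    mderiv a (∑ i ∈ s, c i • F i) = ∑ i ∈ s, c i • mderiv a (F i) := by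
  classical
  induction s using Finset.induction_on with
  | empty => simpa using mderiv_smul 0 (contDiff_const (c := (0 : ℝ))) a
  | insert i s hi ih =>
    rw [Finset.sum_insert hi, Finset.sum_insert hi,
      mderiv_add (f := c i • F i) ((hF i).const_smul (c i)) (contDiff_sum_smul s c F hF),
      mderiv_smul _ (hF i), ih]

/-- The ideal of smooth functions whose jet of order `n` vanishes at the origin absorbs
multiplication by smooth functions. -/
theorem mderiv_mul_eq_zero (n : ℕ) (hf : ContDiff ℝ (⊤ : ℕ∞) f) (hg : ContDiff ℝ (⊤ : ℕ∞) g)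
    (h : ∀ a : Fin d → ℕ, ∑ i, a i ≤ n → mderiv a f 0 = 0) (b : Fin d → ℕ)
    (hb : ∑ i, b i ≤ n) : mderiv b (f * g) 0 = 0 := by
  have hf0 : f 0 = 0 := by simpa [mderiv_zero] using h 0 (by simp)
  induction n generalizing f g b with
  | zero =>
    have : b = 0 := by
      funext i
      exact Finset.sum_eq_zero_iff.mp (Nat.le_zero.mp hb) i (Finset.mem_univ i)
    simp [this, mderiv_zero, hf0]
  | succ n ih =>
    by_cases hb0 : b = 0
    · simp [hb0, mderiv_zero, hf0]
    obtain ⟨i, hi⟩ := Function.ne_iff.mp hb0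
    have hle : Pi.single i 1 ≤ b := by
      intro j
      by_cases hj : j = i
      · subst hj; simpa using Nat.one_le_iff_ne_zero.mpr hi
      · simp [Pi.single_eq_of_ne hj]
    obtain ⟨c, rfl⟩ : ∃ c, b = c + Pi.single i 1 :=
      ⟨b - Pi.single i 1, (tsub_add_cancel_of_le hle).symm⟩
    have hsum : ∀ a : Fin d → ℕ, ∑ j, (a + Pi.single i 1 : Fin d → ℕ) j = ∑ j, a j + 1 := by
      intro a; simp [Finset.sum_add_distrib]
    rw [hsum] at hb
    have hfi := contDiff_pderivFun hf i
    have hgi := contDiff_pderivFun hg i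
    have hD : ∀ a : Fin d → ℕ, ∑ j, a j ≤ n → mderiv a (pderivFun i f) 0 = 0 := by
      intro a ha
      rw [mderiv_pderivFun hf]
      exact h _ (by rw [hsum]; omega)
    rw [← mderiv_pderivFun (f := f * g) (hf.mul hg), pderivFun_mul hf hg,
      mderiv_add (f := pderivFun i f * g) (g := f * pderivFun i g) (hfi.mul hg) (hf.mul hgi),
      Pi.add_apply,
      ih hfi hg hD c (by omega) (by simpa [mderiv_zero] using hD 0 (by simp)),
      ih hf hgi (fun a ha => h a (by omega)) c (by omega) hf0, add_zero]

end mderiv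

section monomials

variable {d : ℕ}

/-- The monomial function `x ↦ x^a`. -/
def monomialFun (a : Fin d → ℕ) : (Fin d → ℝ) → ℝ := fun x => ∏ i, x i ^ a i

theorem contDiff_monomialFun (a : Fin d → ℕ) : ContDiff ℝ (⊤ : ℕ∞) (monomialFun a) :=
  contDiff_prod fun i _ => (contDiff_apply ℝ ℝ i).pow (a i)

theorem pderivFun_monomialFun (i : Fin d) (a : Fin d → ℕ) :
    pderivFun i (monomialFun a) = (a i : ℝ) • monomialFun (a - Pi.single i 1) := by
  funext x
  have h : HasFDerivAt (monomialFun a) _ x := HasFDerivAt.finsetProd (u := Finset.univ)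
    (g := fun j (x : Fin d → ℝ) => x j ^ a j)
    fun j _ => (hasFDerivAt_apply (𝕜 := ℝ) j x).pow (a j)
  rw [pderivFun, h.fderiv]
  simp only [_root_.sum_apply, _root_.smul_apply,
    ContinuousLinearMap.proj_apply, smul_eq_mul, Pi.smul_apply]
  rw [Finset.sum_eq_single i (fun j _ hj => by simp [Pi.single_eq_of_ne hj]) (by simp),
    monomialFun, ← Finset.mul_prod_erase Finset.univ _ (Finset.mem_univ i)]
  have he : ∏ j ∈ Finset.univ.erase i, x j ^ (a - Pi.single i 1 : Fin d → ℕ) j =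
      ∏ j ∈ Finset.univ.erase i, x j ^ a j :=
    Finset.prod_congr rfl fun j hj => by simp [Pi.single_eq_of_ne (Finset.ne_of_mem_erase hj)]
  rw [he]
  simp
  ring

theorem iterate_pderivFun_monomialFun (i : Fin d) (a : Fin d → ℕ) (k : ℕ) :
    (pderivFun i)^[k] (monomialFun a) =
      ((a i).descFactorial k : ℝ) • monomialFun (a - Pi.single i k) := by
  induction k with
  | zero => simp
  | succ k ih =>
    have h : a - Pi.single i k - Pi.single i 1 = a - Pi.single i (k + 1) := by
      rw [tsub_tsub, ← Pi.single_add]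
    rw [Function.iterate_succ_apply', ih, pderivFun_smul _ (contDiff_monomialFun _),
      pderivFun_monomialFun, h, smul_smul, Nat.descFactorial_succ]
    simp [mul_comm]

theorem mderivList_monomialFun {l : List (Fin d)} (hl : l.Nodup) (a b : Fin d → ℕ) :
    mderivList l b (monomialFun a) =
      (∏ i ∈ l.toFinset, ((a i).descFactorial (b i) : ℝ)) •
        monomialFun (fun i => a i - if i ∈ l then b i else 0) := by
  induction l with
  | nil => simp [mderivList]
  | cons i l ih =>
    rw [List.nodup_cons] at hl
    rw [mderivList_cons, ih hl.2, iterate_pderivFun_smul _ (contDiff_monomialFun _),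
      iterate_pderivFun_monomialFun, smul_smul, List.toFinset_cons,
      Finset.prod_insert (by simpa using hl.1), mul_comm]
    congr 2
    · simp [hl.1]
    · funext j
      by_cases hj : j = i
      · subst hj; simp [hl.1]
      · simp [hj]

theorem mderiv_monomialFun_zero (a b : Fin d → ℕ) :
    mderiv b (monomialFun a) 0 = if a = b then ((∏ i, (a i).factorial : ℕ) : ℝ) else 0 := by
  have h := congrFun (mderivList_monomialFun (List.nodup_finRange d) a b) 0
  have h' : mderiv b (monomialFun a) 0 =
      ∏ i, (((a i).descFactorial (b i) : ℝ) * 0 ^ (a i - b i)) := by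
    rw [Finset.prod_mul_distrib]
    exact h.trans (by simp [monomialFun])
  rw [h']
  split_ifs with hab
  · subst hab; simp [Nat.descFactorial_self]
  · obtain ⟨i, hi⟩ := Function.ne_iff.mp hab
    refine Finset.prod_eq_zero (Finset.mem_univ i) ?_
    rcases lt_or_gt_of_ne hi with hlt | hgt
    · simp [Nat.descFactorial_of_lt hlt]
    · simp [Nat.sub_ne_zero_of_lt hgt]

end monomials

/-- The Taylor polynomial of `φ` of order `ω` at the origin. -/
noncomputable def taylorFun (d ω : ℕ) (φ : (Fin d → ℝ) → ℝ) : (Fin d → ℝ) → ℝ :=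
  ∑ a ∈ Finset.univ.filter (fun a : Fin d → Fin (ω + 1) => (∑ i, ((a i : ℕ))) ≤ ω),
    (mderiv (fun i => (a i : ℕ)) φ 0 / ((∏ i, Nat.factorial (a i : ℕ) : ℕ) : ℝ)) •
      monomialFun fun i => (a i : ℕ)

theorem contDiff_taylorFun (d ω : ℕ) (φ : (Fin d → ℝ) → ℝ) :
    ContDiff ℝ (⊤ : ℕ∞) (taylorFun d ω φ) :=
  contDiff_sum_smul _ _ _ fun _ => contDiff_monomialFun _

theorem mderiv_taylorFun {d ω : ℕ} (φ : (Fin d → ℝ) → ℝ) (b : Fin d → ℕ) (hb : ∑ i, b i ≤ ω) :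
    mderiv b (taylorFun d ω φ) 0 = mderiv b φ 0 := by
  have hlt : ∀ i, b i < ω + 1 := fun i => Nat.lt_succ_of_le
    ((Finset.single_le_sum (fun _ _ => Nat.zero_le _) (Finset.mem_univ i)).trans hb)
  rw [taylorFun, mderiv_sum_smul _ _ _ fun _ => contDiff_monomialFun _, Finset.sum_apply,
    Finset.sum_eq_single (fun i => (⟨b i, hlt i⟩ : Fin (ω + 1)))]
  · have : ((∏ i, (b i).factorial : ℕ) : ℝ) ≠ 0 :=
      Nat.cast_ne_zero.mpr (Finset.prod_ne_zero_iff.mpr fun i _ => Nat.factorial_ne_zero _)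
    rw [Pi.smul_apply, mderiv_monomialFun_zero, if_pos rfl, smul_eq_mul, div_mul_cancel₀ _ this]
  · intro a _ hab
    have : (fun i => (a i : ℕ)) ≠ b := fun h => hab (funext fun i => Fin.ext (congrFun h i))
    rw [Pi.smul_apply, mderiv_monomialFun_zero, if_neg this, smul_zero]
  · intro h
    exact absurd (by simpa using hb) (by simpa using h)

theorem EGsub_eq_sub_mul_taylorFun (d ω : ℕ) (w φ : (Fin d → ℝ) → ℝ) :
    EGsub d ω w φ = φ - w * taylorFun d ω φ := by
  funext x
  simp only [EGsub, taylorFun, Pi.sub_apply, Pi.mul_apply, Finset.sum_apply, Pi.smul_apply,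
    smul_eq_mul, monomialFun]
  congr 2
  exact Finset.sum_congr rfl fun a _ => by ring

/-- The subtraction operator `W_{ω,w}` kills the jet of order `ω` at the origin. -/
theorem mderiv_EGsub_eq_zero {d ω : ℕ} {w φ : (Fin d → ℝ) → ℝ} (hw : IsAdmissible d ω w)
    (hφ : ContDiff ℝ (⊤ : ℕ∞) φ) (b : Fin d → ℕ) (hb : ∑ i, b i ≤ ω) :
    mderiv b (EGsub d ω w φ) 0 = 0 := by
  obtain ⟨hws, hw0, hwd⟩ := hw
  have hP := contDiff_taylorFun d ω φ
  have h1 := contDiff_monomialFun (0 : Fin d → ℕ)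
  have hone : monomialFun (0 : Fin d → ℕ) = 1 := by funext x; simp [monomialFun]
  have hφP : ContDiff ℝ (⊤ : ℕ∞) (φ - taylorFun d ω φ) := hφ.sub hP
  have hw1 : ContDiff ℝ (⊤ : ℕ∞) (w - monomialFun 0) := hws.sub h1
  have hsplit : EGsub d ω w φ =
      (φ - taylorFun d ω φ) - (w - monomialFun 0) * taylorFun d ω φ := by
    rw [EGsub_eq_sub_mul_taylorFun, hone]; ring
  have hflat : ∀ a : Fin d → ℕ, ∑ i, a i ≤ ω → mderiv a (w - monomialFun 0) 0 = 0 := by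
    intro a ha
    by_cases ha0 : a = 0
    · simp [ha0, mderiv_zero, hone, hw0]
    · have hpos : 1 ≤ ∑ i, a i := by
        obtain ⟨i, hi⟩ := Function.ne_iff.mp ha0
        exact (Nat.one_le_iff_ne_zero.mpr hi).trans
          (Finset.single_le_sum (fun _ _ => Nat.zero_le _) (Finset.mem_univ i))
      rw [mderiv_sub hws h1, Pi.sub_apply, hwd a hpos ha, mderiv_monomialFun_zero,
        if_neg (Ne.symm ha0), sub_zero]
  rw [hsplit, mderiv_sub (g := (w - monomialFun 0) * taylorFun d ω φ) hφP (hw1.mul hP),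
    mderiv_sub hφ hP, Pi.sub_apply, Pi.sub_apply, mderiv_taylorFun φ b hb,
    mderiv_mul_eq_zero ω hw1 hP hflat b hb,
    sub_self, sub_zero]

/-- nested subtractions annihilate, `S_Γ ∘ W_γ = 0`: if `ω_γ ≥ ω_Γ` then
`W_Γ(W_γ φ) = W_γ φ` for every smooth `φ`. -/
theorem EGsub_nested (d : ℕ) (hd : 1 ≤ d) (ωΓ ωγ : ℕ) (hω : ωΓ ≤ ωγ)
    (wΓ wγ : (Fin d → ℝ) → ℝ)
    (hwΓ : IsAdmissible d ωΓ wΓ) (hwγ : IsAdmissible d ωγ wγ)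
    (φ : (Fin d → ℝ) → ℝ) (hφ : ContDiff ℝ (⊤ : ℕ∞) φ) :
    EGsub d ωΓ wΓ (EGsub d ωγ wγ φ) = EGsub d ωγ wγ φ := by
  have hzero : taylorFun d ωΓ (EGsub d ωγ wγ φ) = 0 :=
    Finset.sum_eq_zero fun a ha => by
      rw [mderiv_EGsub_eq_zero hwγ hφ _ ((Finset.mem_filter.mp ha).2.trans hω), zero_div, zero_smul]
  rw [EGsub_eq_sub_mul_taylorFun, hzero, mul_zero, sub_zero]
end

section
/- (Uniqueness of the extension for negative singular order.) Let t₁, t₂ ∈ 𝒮'(ℝⁿ) each admit a scaling bound strictly smaller than n, and suppose ⟨t₁, φ⟩ = ⟨t₂, φ⟩ for every Schwartz function φ that vanishes on some neighbourhood of the origin. Then t₁ = t₂. (Hence a distribution defined away from the origin with singular order ω < 0 has at most one extension of the same scaling degree.) -/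
open SchwartzMap Filter Topology Set

noncomputable section

/-- `ℝⁿ` with the Euclidean norm. -/
abbrev Eucl (n : ℕ) := EuclideanSpace ℝ (Fin n)

/-- The continuous linear equivalence `x ↦ c • x` of `ℝⁿ`, for `c ≠ 0`. -/
def smulEquiv (n : ℕ) (c : ℝ) (hc : c ≠ 0) : Eucl n ≃L[ℝ] Eucl n :=
  { LinearEquiv.smulOfNeZero ℝ (Eucl n) c hc with
    continuous_toFun := continuous_const_smul c
    continuous_invFun := continuous_const_smul c⁻¹ }

/-- The dilate `x ↦ φ(x/λ)` of a Schwartz function (junk value `φ` for `λ = 0`). -/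
def dilate {n : ℕ} (lam : ℝ) (φ : 𝓢(Eucl n, ℝ)) : 𝓢(Eucl n, ℝ) :=
  if hlam : lam = 0 then φ
  else SchwartzMap.compCLMOfContinuousLinearEquiv ℝ (smulEquiv n lam⁻¹ (inv_ne_zero hlam)) φ

/-- `s` is a scaling bound (at the origin) for the tempered distribution `f`:
`λ^s ⟨f_λ, φ⟩ → 0` as `λ → 0⁺`, where `⟨f_λ, φ⟩ := λ^{−n} ⟨f, φ(·/λ)⟩`. -/
def IsScalingBound (n : ℕ) (f : 𝓢(Eucl n, ℝ) →L[ℝ] ℝ) (s : ℝ) : Prop :=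
  ∀ φ : 𝓢(Eucl n, ℝ),
    Tendsto (fun lam : ℝ => lam ^ s * (lam ^ (-(n : ℝ)) * f (dilate lam φ)))
      (nhdsWithin 0 (Set.Ioi 0)) (nhds 0)

/-- The scaling degree of `f` at the origin: the infimum of its scaling bounds
(in the extended reals). -/
def scalingDegree (n : ℕ) (f : 𝓢(Eucl n, ℝ) →L[ℝ] ℝ) : EReal :=
  sInf {x : EReal | ∃ s : ℝ, x = (s : EReal) ∧ IsScalingBound n f s}

open scoped ContDiff

theorem dilate_apply {n : ℕ} {c : ℝ} (hc : c ≠ 0) (φ : 𝓢(Eucl n, ℝ)) (x : Eucl n) :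
    dilate c φ x = φ (c⁻¹ • x) := by
  simp only [dilate, dif_neg hc]
  rfl

theorem iteratedFDeriv_dilate_zero {n : ℕ} {c : ℝ} (hc : c ≠ 0) (φ : 𝓢(Eucl n, ℝ)) (i : ℕ) :
    iteratedFDeriv ℝ i (dilate c φ) 0 = c⁻¹ ^ i • iteratedFDeriv ℝ i φ 0 := by
  have h : (dilate c φ : Eucl n → ℝ) = fun x => φ (c⁻¹ • x) := funext (dilate_apply hc φ)
  simp [h, iteratedFDeriv_comp_const_smul _ (φ.smooth i)]

section Flat

variable {E : Type*} [NormedAddCommGroup E] [NormedSpace ℝ E]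

/-- If all derivatives of `g` of order `< L` vanish at the origin, the derivative of order `j` is
`O(‖x‖ ^ (L - j))`. -/
theorem SchwartzMap.norm_iteratedFDeriv_le_of_flat (g : 𝓢(E, ℝ)) (L : ℕ)
    (hg : ∀ i < L, iteratedFDeriv ℝ i g 0 = 0) (m j : ℕ) (hj : j + m = L) :
    ∃ C : ℝ, 0 ≤ C ∧ ∀ x, ‖iteratedFDeriv ℝ j g x‖ ≤ C * ‖x‖ ^ m := by
  induction m generalizing j with
  | zero =>
    obtain ⟨C, hC, h⟩ := g.decay 0 j
    exact ⟨C, hC.le, fun x => by simpa using h x⟩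
  | succ m ih =>
    obtain ⟨C, hC, h⟩ := ih (j + 1) (by lia)
    refine ⟨C, hC, fun x => ?_⟩
    have hd : Differentiable ℝ (iteratedFDeriv ℝ j g) :=
      (g.smooth (j + 1)).differentiable_iteratedFDeriv (by exact_mod_cast Nat.lt_succ_self j)
    have := (convex_closedBall (0 : E) ‖x‖).norm_image_sub_le_of_norm_fderiv_le (𝕜 := ℝ)
      (f := iteratedFDeriv ℝ j g) (C := C * ‖x‖ ^ m) (x := 0) (y := x)
      (fun y _ => hd y) (fun y hy => ?_) (by simp) (by simp)
    · rw [hg j (by lia), sub_zero, sub_zero] at this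
      rwa [pow_succ, ← mul_assoc]
    · rw [norm_fderiv_iteratedFDeriv]
      refine (h y).trans ?_
      have : ‖y‖ ≤ ‖x‖ := by simpa using hy
      gcongr

variable [FiniteDimensional ℝ E]

/-- Cutting off a function which is flat to order `L` at scale `c` yields a function whose
seminorms involving fewer than `L` derivatives are `O(c)`. -/
theorem SchwartzMap.seminorm_cutoff_le (χ : E → ℝ) (hχ : ContDiff ℝ ∞ χ)
    (hsupp : tsupport χ ⊆ Metric.closedBall 0 2)
    (g : 𝓢(E, ℝ)) (L : ℕ) (hg : ∀ i < L, iteratedFDeriv ℝ i g 0 = 0) (k l : ℕ) (hl : l < L) :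
    ∃ K : ℝ, 0 ≤ K ∧ ∀ c : ℝ, 0 < c → c ≤ 1 → ∀ ψ : 𝓢(E, ℝ),
      (∀ x, ψ x = χ (c⁻¹ • x) * g x) → SchwartzMap.seminorm ℝ k l ψ ≤ K * c := by
  have hcs : HasCompactSupport χ :=
    (isCompact_closedBall (0 : E) 2).of_isClosed_subset (isClosed_tsupport χ) hsupp
  have hA : ∀ i : ℕ, ∃ A : ℝ, ∀ x, ‖iteratedFDeriv ℝ i χ x‖ ≤ A := fun i =>
    (hχ.continuous_iteratedFDeriv (by exact_mod_cast le_top)).bounded_above_of_compact_support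
      (hcs.iteratedFDeriv i)
  choose A hA using hA
  have hA0 : ∀ i, 0 ≤ A i := fun i => (norm_nonneg _).trans (hA i 0)
  have hB : ∀ i : ℕ, ∃ B : ℝ, 0 ≤ B ∧
      (i ≤ l → ∀ x, ‖iteratedFDeriv ℝ (l - i) g x‖ ≤ B * ‖x‖ ^ (L - l + i)) := fun i => by
    by_cases hi : i ≤ l
    · obtain ⟨B, hB, h⟩ := g.norm_iteratedFDeriv_le_of_flat L hg (L - l + i) (l - i) (by lia)
      exact ⟨B, hB, fun _ => h⟩
    · exact ⟨0, le_rfl, fun h => absurd h hi⟩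
  choose B hB0 hB using hB
  refine ⟨2 ^ k * ∑ i ∈ Finset.range (l + 1), (l.choose i : ℝ) * A i * (B i * 2 ^ (L - l + i)),
    mul_nonneg (by positivity) (Finset.sum_nonneg fun i _ => ?_), fun c hc hc1 ψ hψ => ?_⟩
  · have := hA0 i
    have := hB0 i
    positivity
  have hχc : ContDiff ℝ ∞ fun x => χ (c⁻¹ • x) := hχ.comp (contDiff_const_smul _)
  refine SchwartzMap.seminorm_le_bound ℝ k l ψ ?_ fun x => ?_
  · refine mul_nonneg (mul_nonneg (by positivity) (Finset.sum_nonneg fun i _ => ?_)) hc.le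
    have := hA0 i
    have := hB0 i
    positivity
  rw [show (ψ : E → ℝ) = fun x => χ (c⁻¹ • x) * g x from funext hψ]
  have hprod := norm_iteratedFDeriv_mul_le (𝕜 := ℝ) hχc (g.smooth ⊤) x (n := l)
    (by exact_mod_cast le_top)
  have hterm : ∀ i ∈ Finset.range (l + 1),
      ‖x‖ ^ k * ((l.choose i : ℝ) * ‖iteratedFDeriv ℝ i (fun x => χ (c⁻¹ • x)) x‖ *
        ‖iteratedFDeriv ℝ (l - i) g x‖) ≤
      2 ^ k * ((l.choose i : ℝ) * A i * (B i * 2 ^ (L - l + i))) * c := fun i hi => by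
    have hil : i ≤ l := by simpa [Nat.lt_succ_iff] using hi
    have := hA0 i
    have := hB0 i
    rw [iteratedFDeriv_comp_const_smul _ (hχ.of_le (by exact_mod_cast le_top))]
    by_cases hx : ‖x‖ ≤ 2 * c
    · rw [norm_smul, norm_pow, norm_inv, Real.norm_of_nonneg hc.le]
      calc _ ≤ 2 ^ k * ((l.choose i : ℝ) * (c⁻¹ ^ i * A i) *
              (B i * (2 * c) ^ (L - l + i))) := by
            have h2 : ‖x‖ ≤ 2 := hx.trans (by linarith)
            gcongr
            · exact hA i _
            · exact (hB i hil x).trans (by gcongr)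
        _ = 2 ^ k * ((l.choose i : ℝ) * A i * (B i * 2 ^ (L - l + i))) * c ^ (L - l) := by
            rw [mul_pow, pow_add c, inv_pow]
            field_simp
        _ ≤ _ := by
            gcongr
            exact pow_le_of_le_one hc.le hc1 (by lia)
    · have h0 : iteratedFDeriv ℝ i χ (c⁻¹ • x) = 0 := by
        by_contra hne
        have := hsupp (support_iteratedFDeriv_subset i hne)
        rw [mem_closedBall_zero_iff, norm_smul, norm_inv, Real.norm_of_nonneg hc.le,
          inv_mul_le_iff₀ hc] at this
        exact hx (by linarith)
      beta_reduce
      rw [h0, smul_zero, norm_zero, mul_zero, zero_mul, mul_zero]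
      positivity
  calc _ ≤ ‖x‖ ^ k * ∑ i ∈ Finset.range (l + 1), (l.choose i : ℝ) *
        ‖iteratedFDeriv ℝ i (fun x => χ (c⁻¹ • x)) x‖ * ‖iteratedFDeriv ℝ (l - i) g x‖ := by
        gcongr
    _ ≤ _ := by
        rw [Finset.mul_sum, Finset.mul_sum, Finset.sum_mul]
        exact Finset.sum_le_sum hterm

/-- A tempered distribution supported at the origin has finite order: it annihilates every
Schwartz function that is sufficiently flat there. -/
theorem SchwartzMap.exists_flat_order (u : 𝓢(E, ℝ) →L[ℝ] ℝ)
    (hu : ∀ φ : 𝓢(E, ℝ), (∀ᶠ x in 𝓝 (0 : E), φ x = 0) → u φ = 0) :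
    ∃ L : ℕ, ∀ g : 𝓢(E, ℝ), (∀ i < L, iteratedFDeriv ℝ i g 0 = 0) → u g = 0 := by
  obtain ⟨s, C, -, hC⟩ := Seminorm.bound_of_continuous (schwartz_withSeminorms ℝ E ℝ)
    ((normSeminorm ℝ ℝ).comp u.toLinearMap) (continuous_norm.comp u.continuous)
  refine ⟨s.sup Prod.snd + 1, fun g hg => ?_⟩
  let χ : ContDiffBump (0 : E) := ⟨1, 2, one_pos, one_lt_two⟩
  have hχ : ContDiff ℝ ∞ (χ : E → ℝ) := χ.contDiff
  have hK : ∀ p : ℕ × ℕ, ∃ K : ℝ, 0 ≤ K ∧ (p ∈ s → ∀ c : ℝ, 0 < c → c ≤ 1 → ∀ ψ : 𝓢(E, ℝ),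
      (∀ x, ψ x = χ (c⁻¹ • x) * g x) → SchwartzMap.seminorm ℝ p.1 p.2 ψ ≤ K * c) := fun p => by
    by_cases hp : p ∈ s
    · obtain ⟨K, hK0, hK⟩ := SchwartzMap.seminorm_cutoff_le χ hχ χ.tsupport_eq.subset g _ hg
        p.1 p.2 (Nat.lt_succ_of_le (Finset.le_sup (f := Prod.snd) hp))
      exact ⟨K, hK0, fun _ => hK⟩
    · exact ⟨0, le_rfl, fun h => absurd h hp⟩
  choose K hK0 hK using hK
  have hsum : 0 ≤ ∑ p ∈ s, K p := Finset.sum_nonneg fun p _ => hK0 p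
  have hbound : ∀ c : ℝ, 0 < c → c ≤ 1 → ‖u g‖ ≤ C * ((∑ p ∈ s, K p) * c) := fun c hc hc1 => by
    have hχc : ContDiff ℝ ∞ fun x : E => χ (c⁻¹ • x) := hχ.comp (contDiff_const_smul _)
    have htg : Function.HasTemperateGrowth fun x : E => χ (c⁻¹ • x) :=
      HasCompactSupport.hasTemperateGrowth (χ.hasCompactSupport.comp_homeomorph
        (Homeomorph.smulOfNeZero c⁻¹ (inv_ne_zero hc.ne'))) hχc
    let ψ : 𝓢(E, ℝ) := smulLeftCLM ℝ (fun x : E => χ (c⁻¹ • x)) g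
    have hψ : ∀ x, ψ x = χ (c⁻¹ • x) * g x := fun x => smulLeftCLM_apply_apply htg g x
    have hug : u g = u ψ := by
      rw [← sub_eq_zero, ← map_sub]
      refine hu _ ?_
      have : Tendsto (fun x : E => c⁻¹ • x) (𝓝 0) (𝓝 0) := by
        simpa using (continuous_const_smul (c⁻¹) (T := E)).tendsto 0
      filter_upwards [this.eventually χ.eventuallyEq_one] with x hx
      have h1 : χ (c⁻¹ • x) = 1 := hx
      simp [hψ, h1]
    rw [hug]
    refine (hC ψ).trans ?_
    rw [smul_apply, NNReal.smul_def, smul_eq_mul]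
    gcongr
    refine Seminorm.finset_sup_apply_le (mul_nonneg hsum hc.le) fun p hp => ?_
    refine (hK p hp c hc hc1 ψ hψ).trans ?_
    gcongr
    exact Finset.single_le_sum (fun p _ => hK0 p) hp
  have hlim : Tendsto (fun c : ℝ => C * ((∑ p ∈ s, K p) * c)) (𝓝[>] 0) (𝓝 0) := by
    have : Continuous fun c : ℝ => (C : ℝ) * ((∑ p ∈ s, K p) * c) := by fun_prop
    simpa using (this.tendsto 0).mono_left nhdsWithin_le_nhds
  refine norm_le_zero_iff.mp (ge_of_tendsto hlim ?_)
  filter_upwards [Ioc_mem_nhdsGT (zero_lt_one' ℝ)] with c hc using hbound c hc.1 hc.2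

end Flat

theorem IsScalingBound.tendsto_dilate {n : ℕ} {t : 𝓢(Eucl n, ℝ) →L[ℝ] ℝ} {s : ℝ}
    (hs : s < n) (h : IsScalingBound n t s) (φ : 𝓢(Eucl n, ℝ)) :
    Tendsto (fun c : ℝ => t (dilate c φ)) (𝓝[>] 0) (𝓝 0) := by
  refine squeeze_zero_norm' ?_ (tendsto_zero_iff_norm_tendsto_zero.mp (h φ))
  filter_upwards [Ioc_mem_nhdsGT (zero_lt_one' ℝ)] with c hc
  have hc0 : 0 < c := hc.1
  rw [← mul_assoc, ← Real.rpow_add hc0, norm_mul, Real.norm_of_nonneg (Real.rpow_nonneg hc0.le _)]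
  exact le_mul_of_one_le_left (norm_nonneg _)
    (Real.one_le_rpow_of_pos_of_le_one_of_nonpos hc0 hc.2 (by linarith))

/-- two tempered distributions which admit scaling bounds `< n` and agree on
all Schwartz functions vanishing near the origin are equal. -/
theorem extension_unique_of_neg_singular_order (n : ℕ) (t₁ t₂ : 𝓢(Eucl n, ℝ) →L[ℝ] ℝ)
    (h₁ : ∃ s : ℝ, s < n ∧ IsScalingBound n t₁ s)
    (h₂ : ∃ s : ℝ, s < n ∧ IsScalingBound n t₂ s)
    (hagree : ∀ φ : 𝓢(Eucl n, ℝ), (∀ᶠ x in nhds (0 : Eucl n), φ x = 0) → t₁ φ = t₂ φ) :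
    t₁ = t₂ := by
  obtain ⟨s₁, hs₁, h₁⟩ := h₁
  obtain ⟨s₂, hs₂, h₂⟩ := h₂
  let u := t₁ - t₂
  have hlim : ∀ φ, Tendsto (fun c : ℝ => u (dilate c φ)) (𝓝[>] 0) (𝓝 0) := fun φ => by
    simpa [u] using (h₁.tendsto_dilate hs₁ φ).sub (h₂.tendsto_dilate hs₂ φ)
  obtain ⟨L, hL⟩ := SchwartzMap.exists_flat_order u fun φ hφ => by
    simpa [u, sub_eq_zero] using hagree φ hφ
  have key : ∀ m ≤ L, ∀ g : 𝓢(Eucl n, ℝ), (∀ i < L - m, iteratedFDeriv ℝ i g 0 = 0) →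
      u g = 0 := by
    intro m
    induction m with
    | zero => exact fun _ => hL
    | succ m ih =>
      intro hm g hg
      have hscale : ∀ c : ℝ, 0 < c → u (dilate c g) = c⁻¹ ^ (L - (m + 1)) * u g := fun c hc => by
        have := ih (by lia) (dilate c g - c⁻¹ ^ (L - (m + 1)) • g) fun i hi => ?_
        · rw [map_sub, map_smul, sub_eq_zero] at this
          exact this
        · have hcoe : ((dilate c g - c⁻¹ ^ (L - (m + 1)) • g : 𝓢(Eucl n, ℝ)) : Eucl n → ℝ) =
              (dilate c g : Eucl n → ℝ) - fun y => c⁻¹ ^ (L - (m + 1)) • g y := rfl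
          rw [hcoe, iteratedFDeriv_sub_apply ((dilate c g).smooth i).contDiffAt
            ((g.smooth i).const_smul (c⁻¹ ^ (L - (m + 1)))).contDiffAt,
            iteratedFDeriv_const_smul_apply' (g.smooth i).contDiffAt,
            iteratedFDeriv_dilate_zero hc.ne']
          rcases Nat.lt_or_ge i (L - (m + 1)) with h | h
          · simp [hg i h]
          · rw [show i = L - (m + 1) by lia, sub_self]
      refine norm_le_zero_iff.mp (ge_of_tendsto
        (tendsto_zero_iff_norm_tendsto_zero.mp (hlim g)) ?_)
      filter_upwards [Ioc_mem_nhdsGT (zero_lt_one' ℝ)] with c hc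
      rw [hscale c hc.1, norm_mul, norm_pow, norm_inv, Real.norm_of_nonneg hc.1.le]
      exact le_mul_of_one_le_left (norm_nonneg _)
        (one_le_pow₀ ((one_le_inv₀ hc.1).mpr hc.2))
  refine sub_eq_zero.mp (ContinuousLinearMap.ext fun g => key L le_rfl g ?_)
  simp
end
end
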